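/- A cocompact Fuchsian group has only finitely many conjugacy classes of finite subgroups. -/

import Mathlib

open UpperHalfPlane Matrix

/-- `SL(2,ℝ)`: 2×2 real matrices of determinant 1. -/
abbrev SL2R := Matrix.SpecialLinearGroup (Fin 2) ℝ

/-- The subspace topology on `SL(2,ℝ)` inherited from 2×2 real matrices. -/
instance : TopologicalSpace SL2R :=
  TopologicalSpace.induced (fun g => (g : Matrix (Fin 2) (Fin 2) ℝ)) inferInstance

/-- `PSL(2,ℝ)`: the quotient of `SL(2,ℝ)` by its center `{±I}`,
with the quotient topology. -/
abbrev PSL2R := SL2R ⧸ Subgroup.center SL2R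


theorem topo_eq : (instTopologicalSpaceSL2R : TopologicalSpace SL2R) =
    Matrix.SpecialLinearGroup.instTopologicalSpace := rfl

theorem sl_topGroup : IsTopologicalGroup SL2R :=
  @Matrix.SpecialLinearGroup.topologicalGroup (Fin 2) ℝ _ _ _ _ _

theorem sl_emb : Topology.IsClosedEmbedding (fun g : SL2R => (g : Matrix (Fin 2) (Fin 2) ℝ)) :=
  Matrix.SpecialLinearGroup.isClosedEmbedding_val

theorem sl_t2 : T2Space SL2R := sl_emb.isEmbedding.t2Space

theorem sl_lc : LocallyCompactSpace SL2R := by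
  have : LocallyCompactSpace (Matrix (Fin 2) (Fin 2) ℝ) :=
    inferInstanceAs (LocallyCompactSpace (Fin 2 → Fin 2 → ℝ))
  exact sl_emb.locallyCompactSpace

theorem center_fin : Finite (Subgroup.center SL2R) := by
  have : NeZero (max (Fintype.card (Fin 2)) 1) := ⟨by simp⟩
  exact Finite.of_equiv _ (Matrix.SpecialLinearGroup.center_equiv_rootsOfUnity (n := Fin 2)
    (R := ℝ)).symm.toEquiv

/-- matrices in `SL2R` with entries in `[-1,1]` -/
def boxK : Set SL2R := {g | ∀ i j, (g : Matrix (Fin 2) (Fin 2) ℝ) i j ∈ Set.Icc (-1 : ℝ) 1}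

theorem boxK_compact : IsCompact boxK := by
  have h : IsCompact (Set.pi Set.univ fun _ : Fin 2 => Set.pi Set.univ
      fun _ : Fin 2 => Set.Icc (-1 : ℝ) 1) :=
    isCompact_univ_pi fun _ => isCompact_univ_pi fun _ => isCompact_Icc
  have h2 := sl_emb.isCompact_preimage (K := (Set.pi Set.univ fun _ : Fin 2 => Set.pi Set.univ
      fun _ : Fin 2 => Set.Icc (-1 : ℝ) 1)) h
  convert h2 using 1
  ext g
  exact ⟨fun h i _ j _ => h i j, fun h i j => h i trivial j trivial⟩

theorem orth_mem_boxK (g : SL2R)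
    (h : (g : Matrix (Fin 2) (Fin 2) ℝ)ᵀ * (g : Matrix (Fin 2) (Fin 2) ℝ) = 1) : g ∈ boxK := by
  have h0 := congrFun (congrFun h 0) 0
  have h1 := congrFun (congrFun h 1) 1
  simp [Matrix.mul_apply, Fin.sum_univ_two] at h0 h1
  intro i j
  fin_cases i <;> fin_cases j <;> constructor <;> simp <;> nlinarith

theorem cholesky (S : Matrix (Fin 2) (Fin 2) ℝ) (hS : S.PosDef) :
    ∃ (g : SL2R) (r : ℝ), 0 < r ∧
      S = r • ((g : Matrix (Fin 2) (Fin 2) ℝ)ᵀ * (g : Matrix (Fin 2) (Fin 2) ℝ)) := by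
  have ha : 0 < S 0 0 := hS.diag_pos
  have hd : 0 < S.det := hS.det_pos
  have hs : S 1 0 = S 0 1 := by simpa using hS.isHermitian.apply 0 1
  rw [Matrix.det_fin_two, hs] at hd
  set a := S 0 0 with ha'
  set b := S 0 1 with hb'
  set c := S 1 1 with hc'
  obtain ⟨r, hr, hr2⟩ : ∃ r : ℝ, 0 < r ∧ r ^ 2 = a * c - b * b :=
    ⟨_, Real.sqrt_pos.2 hd, Real.sq_sqrt hd.le⟩
  obtain ⟨t, ht, ht2⟩ : ∃ t : ℝ, 0 < t ∧ t ^ 2 = a / r :=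
    ⟨_, Real.sqrt_pos.2 (div_pos ha hr), Real.sq_sqrt (div_pos ha hr).le⟩
  have hat : a = r * t ^ 2 := by rw [ht2]; field_simp
  refine ⟨⟨!![t, b / (r * t); 0, 1 / t], ?_⟩, r, hr, ?_⟩
  · rw [Matrix.det_fin_two]; simp; field_simp
  · have hc : c = (r ^ 2 + b * b) / a := by field_simp; linarith
    ext i j
    fin_cases i <;> fin_cases j <;> simp [Matrix.mul_apply, Fin.sum_univ_two]
    · rw [← ha', hat]; ring
    · rw [← hb']; field_simp
    · rw [hs]; field_simp
    · rw [← hc', hc, hat]; field_simp; ring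

/-- Every finite subgroup of `SL2R` is conjugate into the orthogonal matrices. -/
theorem finite_conj (H : Subgroup SL2R) (hH : Finite H) :
    ∃ g : SL2R, ∀ h ∈ H, g * h * g⁻¹ ∈ boxK := by
  have := Fintype.ofFinite H
  let f : H → Matrix (Fin 2) (Fin 2) ℝ := fun h => ((h : SL2R) : Matrix (Fin 2) (Fin 2) ℝ)ᵀ *
    ((h : SL2R) : Matrix (Fin 2) (Fin 2) ℝ)
  have hf : ∀ h, (f h).PosDef := by
    intro h
    have := Matrix.PosDef.conjTranspose_mul_self ((h : SL2R) : Matrix (Fin 2) (Fin 2) ℝ) (by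
      apply Matrix.mulVec_injective_of_isUnit
      rw [Matrix.isUnit_iff_isUnit_det]; simp)
    simpa [f] using this
  have hS : (∑ h, f h).PosDef := Matrix.posDef_sum Finset.univ_nonempty fun i _ => hf i
  obtain ⟨g, r, hr, hg⟩ := cholesky _ hS
  refine ⟨g, fun h hh => orth_mem_boxK _ ?_⟩
  have inv : (h : Matrix (Fin 2) (Fin 2) ℝ)ᵀ * (∑ h, f h) * (h : Matrix (Fin 2) (Fin 2) ℝ)
      = ∑ h, f h := by
    rw [Finset.mul_sum, Finset.sum_mul, ← Equiv.sum_comp (Equiv.mulRight (⟨h, hh⟩ : H)) f]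
    refine Finset.sum_congr rfl fun k _ => ?_
    simp [f, Matrix.transpose_mul, Matrix.mul_assoc]
  rw [hg] at inv
  simp only [Matrix.mul_smul, Matrix.smul_mul] at inv
  have inv2 := smul_right_injective _ hr.ne' inv
  simp only [Matrix.SpecialLinearGroup.coe_mul, Matrix.transpose_mul]
  have e : (g : Matrix (Fin 2) (Fin 2) ℝ) * ((g⁻¹ : SL2R) : Matrix (Fin 2) (Fin 2) ℝ) = 1 := by
    rw [← Matrix.SpecialLinearGroup.coe_mul]; simp
  have e2 := congrArg Matrix.transpose e
  rw [Matrix.transpose_mul, Matrix.transpose_one] at e2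
  set G := (g : Matrix (Fin 2) (Fin 2) ℝ)
  set G' := ((g⁻¹ : SL2R) : Matrix (Fin 2) (Fin 2) ℝ)
  set A := (h : Matrix (Fin 2) (Fin 2) ℝ)
  calc G'ᵀ * (Aᵀ * Gᵀ) * (G * A * G') = G'ᵀ * (Aᵀ * (Gᵀ * G) * A) * G' := by
        simp only [Matrix.mul_assoc]
    _ = (G'ᵀ * Gᵀ) * (G * G') := by rw [inv2]; simp only [Matrix.mul_assoc]
    _ = 1 := by rw [e, e2, Matrix.one_mul]

theorem finite_comap (H : Subgroup PSL2R) (hH : Finite H) :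
    Finite (H.comap (QuotientGroup.mk' (Subgroup.center SL2R))) := by
  have := center_fin
  apply Set.Finite.preimage' (s := (H : Set PSL2R)) (Set.toFinite _)
  intro b _
  obtain ⟨x, rfl⟩ := QuotientGroup.mk_surjective b
  refine ((Set.toFinite (Subgroup.center SL2R : Set SL2R)).image (fun z => x * z)).subset ?_
  intro y hy
  exact ⟨x⁻¹ * y, QuotientGroup.eq.1 (Eq.symm hy), by simp⟩

theorem compact_lift {G : Type*} [Group G] [TopologicalSpace G] [IsTopologicalGroup G]
    [LocallyCompactSpace G] (Γ : Subgroup G) (hc : CompactSpace (G ⧸ Γ)) :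
    ∃ C : Set G, IsCompact C ∧ ∀ g : G, ∃ c ∈ C, ∃ γ ∈ Γ, g = c * γ := by
  choose N hN hN1 using fun x : G => exists_compact_mem_nhds x
  obtain ⟨t, -, ht⟩ := isCompact_univ.elim_nhds_subcover
    (fun q : G ⧸ Γ => (QuotientGroup.mk '' N q.out : Set (G ⧸ Γ))) (fun q _ => by
      have := (QuotientGroup.isOpenMap_coe (N := Γ)).image_mem_nhds (hN1 q.out)
      simpa using this)
  refine ⟨⋃ q ∈ t, N q.out, t.isCompact_biUnion fun q _ => hN _, fun g => ?_⟩
  have := ht (Set.mem_univ (g : G ⧸ Γ))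
  simp only [Set.mem_iUnion] at this
  obtain ⟨q, hq, c, hc, hcg⟩ := this
  refine ⟨c, Set.mem_biUnion hq hc, c⁻¹ * g, QuotientGroup.eq.1 hcg, by simp⟩

/-- A cocompact Fuchsian group `Γ ≤ PSL(2,ℝ)` has only finitely many conjugacy
classes of finite subgroups: there is a finite set `T` of subgroups of `Γ` such
that every finite subgroup of `Γ` is conjugate (in `Γ`) to a member of `T`. -/
theorem finitely_many_conjugacy_classes_of_finite_subgroups
    (Γ : Subgroup PSL2R) (hd : DiscreteTopology Γ) (hc : CompactSpace (PSL2R ⧸ Γ)) :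
    ∃ T : Set (Subgroup Γ), T.Finite ∧
      ∀ H : Subgroup Γ, Finite H →
        ∃ K ∈ T, ∃ γ : Γ, H.map (MulAut.conj γ).toMonoidHom = K := by
  have := sl_topGroup
  have := sl_t2
  have := sl_lc
  have := center_fin
  have : IsClosed (Subgroup.center SL2R : Set SL2R) := (Set.toFinite _).isClosed
  have : T3Space PSL2R := QuotientGroup.instT3Space _
  obtain ⟨C, hC, hCΓ⟩ := compact_lift Γ hc
  let π : SL2R →* PSL2R := QuotientGroup.mk' (Subgroup.center SL2R)
  have hπ : Continuous π := QuotientGroup.continuous_mk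
  let D : Set PSL2R := (fun p : PSL2R × PSL2R => p.1⁻¹ * p.2 * p.1) '' (C ×ˢ (π '' boxK))
  have hD : IsCompact D := (hC.prod (boxK_compact.image hπ)).image (by fun_prop)
  have hF : {k : Γ | (k : PSL2R) ∈ D}.Finite := by
    have hcl : IsClosed (Γ : Set PSL2R) := Subgroup.isClosed_of_discrete
    exact (hcl.isClosedEmbedding_subtypeVal.isCompact_preimage hD).finite_of_discrete
  refine ⟨{K | ∀ k ∈ K, (k : PSL2R) ∈ D}, ?_, ?_⟩
  · refine (hF.finite_subsets.preimage (f := fun K : Subgroup Γ => (K : Set Γ))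
      SetLike.coe_injective.injOn).subset ?_
    intro K hK k hk
    exact hK k hk
  · intro H hH
    have : Finite (H.map Γ.subtype) :=
      Set.Finite.to_subtype ((Set.toFinite (H : Set Γ)).image Γ.subtype)
    obtain ⟨g, hg⟩ := finite_conj _ (finite_comap (H.map Γ.subtype) this)
    obtain ⟨c, hc, γ, hγ, hgc⟩ := hCΓ (π g)
    refine ⟨_, ?_, ⟨γ, hγ⟩, rfl⟩
    rintro _ ⟨h, hh, rfl⟩
    obtain ⟨x, hx⟩ := QuotientGroup.mk'_surjective (Subgroup.center SL2R) (h : PSL2R)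
    refine ⟨(c, π (g * x * g⁻¹)), ⟨hc, _, hg x ?_, rfl⟩, ?_⟩
    · exact ⟨h, hh, hx.symm⟩
    · have hx' : π x = h := hx
      simp only [map_mul, map_inv, hgc, hx']
      simp [mul_assoc]
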